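/- Let G be an n×n invertible complex matrix with singular values σ_1 ≥ ... ≥ σ_n, and let Q_s be a positive semidefinite Hermitian matrix with eigenvalues p_1 ≥ ... ≥ p_n. Then log det(I + G Q_s G†) ≥ Σ_{i=1}^n log(1 + σ_i² p_{n+1-i}). -/

import Mathlib

open Matrix ComplexOrder

/-- Averaging against a doubly stochastic matrix cannot go below the antitone rearrangement. -/
theorem sum_mul_le_sum_of_mem_doublyStochastic {ι : Type*} [Fintype ι] [DecidableEq ι]
    {S : Matrix ι ι ℝ} (hS : S ∈ doublyStochastic ℝ ι) {a g : ι → ℝ} {e : Equiv.Perm ι}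
    (h : Antivary (a ∘ e) g) :
    ∑ i, a (e i) * g i ≤ ∑ i, ∑ j, a i * S i j * g j := by
  obtain ⟨w, hw0, hw1, rfl⟩ := exists_eq_sum_perm_of_mem_doublyStochastic hS
  have hperm (π : Equiv.Perm ι) : ∑ i, a (e i) * g i ≤ ∑ i, a i * g (π i) := by
    have h1 := h.sum_mul_le_sum_mul_comp_perm (σ := e.trans π)
    rw [← Equiv.sum_comp e (fun i => a i * g (π i))]
    simpa using h1
  have heq : ∑ i, ∑ j, a i * (∑ π, w π • Equiv.Perm.permMatrix ℝ π) i j * g j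
      = ∑ π, w π * ∑ i, a i * g (π i) := by
    have h1 (i : ι) : ∑ j, a i * (∑ π, w π • Equiv.Perm.permMatrix ℝ π) i j * g j
        = ∑ π, w π * (a i * g (π i)) := by
      simp only [Matrix.sum_apply, Matrix.smul_apply, smul_eq_mul, Finset.mul_sum,
        Finset.sum_mul]
      rw [Finset.sum_comm]
      refine Finset.sum_congr rfl fun π _ => ?_
      rw [Finset.sum_eq_single (π i)]
      · simp [Equiv.Perm.permMatrix, PEquiv.toMatrix_apply]
        ring
      · intro j _ hj
        simp [Equiv.Perm.permMatrix, PEquiv.toMatrix_apply, hj.symm]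
      · simp
    simp_rw [h1, Finset.mul_sum]
    exact Finset.sum_comm
  rw [heq]
  calc ∑ i, a (e i) * g i = ∑ π, w π * ∑ i, a (e i) * g i := by
        rw [← Finset.sum_mul, hw1, one_mul]
    _ ≤ _ := Finset.sum_le_sum fun π _ => mul_le_mul_of_nonneg_left (hperm π) (hw0 π)

/-- The squared moduli of the entries of a unitary matrix form a doubly stochastic matrix. -/
theorem normSq_mem_doublyStochastic {ι : Type*} [Fintype ι] [DecidableEq ι]
    {Y : Matrix ι ι ℂ} (hY : Y ∈ Matrix.unitaryGroup ι ℂ) :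
    Matrix.of (fun i j => Complex.normSq (Y i j)) ∈ doublyStochastic ℝ ι := by
  refine mem_doublyStochastic_iff_sum.2 ⟨fun i j => Complex.normSq_nonneg _, fun i => ?_,
    fun j => ?_⟩
  · have h := congrFun (congrFun (Matrix.mem_unitaryGroup_iff.1 hY) i) i
    simp only [Matrix.mul_apply, Matrix.star_apply, Matrix.one_apply_eq, RCLike.star_def,
      Complex.mul_conj] at h
    exact_mod_cast h
  · have h := congrFun (congrFun (Matrix.mem_unitaryGroup_iff'.1 hY) j) j
    simp only [Matrix.mul_apply, Matrix.star_apply, Matrix.one_apply_eq, RCLike.star_def,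
      mul_comm, Complex.mul_conj] at h
    exact_mod_cast h

/-- Lower trace inequality: a Hermitian matrix with eigenvalues `a`, paired with a diagonal matrix
with entries `g`, has trace at least the sum over the antitone matching. -/
theorem sum_mul_le_sum_diag_conj_mul {ι : Type*} [Fintype ι] [DecidableEq ι]
    {Y : Matrix ι ι ℂ} (hY : Y ∈ Matrix.unitaryGroup ι ℂ) {a g : ι → ℝ} {e : Equiv.Perm ι}
    (h : Antivary (a ∘ e) g) :
    ∑ i, a (e i) * g i ≤
      ∑ j, ((Yᴴ * Matrix.diagonal (fun i => (a i : ℂ)) * Y) j j).re * g j := by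
  refine (sum_mul_le_sum_of_mem_doublyStochastic (normSq_mem_doublyStochastic hY) h).trans_eq ?_
  rw [Finset.sum_comm]
  refine Finset.sum_congr rfl fun j _ => ?_
  rw [← Finset.sum_mul, Matrix.mul_apply, Complex.re_sum]
  congr 1
  refine Finset.sum_congr rfl fun i _ => ?_
  rw [Matrix.mul_diagonal, Matrix.conjTranspose_apply, RCLike.star_def, mul_right_comm,
    mul_comm (starRingEnd ℂ _), Complex.mul_conj, ← Complex.ofReal_mul, Complex.ofReal_re,
    Matrix.of_apply, mul_comm]

theorem posDef_diagonal_add_conj_diagonal {ι : Type*} [Fintype ι] [DecidableEq ι]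
    {a b : ι → ℝ} (ha : ∀ i, 0 < a i) (hb : ∀ i, 0 ≤ b i) (U : Matrix ι ι ℂ) :
    (Matrix.diagonal (fun i => (a i : ℂ)) +
      U * Matrix.diagonal (fun i => (b i : ℂ)) * Uᴴ).PosDef := by
  refine Matrix.PosDef.add_posSemidef (Matrix.posDef_diagonal_iff.2 fun i => ?_)
    (Matrix.PosSemidef.mul_mul_conjTranspose_same (Matrix.posSemidef_diagonal_iff.2 fun i => ?_) U)
  · exact_mod_cast ha i
  · exact_mod_cast hb i

/-- **Fiedler's inequality**: the determinant of a sum of positive matrices is at least the product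
of the sums of their eigenvalues taken in the same order. -/
theorem sum_log_add_le_log_det_add {n : ℕ} {a b : Fin n → ℝ} (ha : ∀ i, 0 < a i)
    (hb : ∀ i, 0 ≤ b i) (hamono : Monotone a) {e : Equiv.Perm (Fin n)} (hbmono : Monotone (b ∘ e))
    {U : Matrix (Fin n) (Fin n) ℂ} (hU : U ∈ Matrix.unitaryGroup (Fin n) ℂ) :
    ∑ i, Real.log (a i + b (e i)) ≤
      Real.log (Matrix.diagonal (fun i => (a i : ℂ)) +
        U * Matrix.diagonal (fun i => (b i : ℂ)) * Uᴴ).det.re := by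
  set A : Matrix (Fin n) (Fin n) ℂ := Matrix.diagonal (fun i => (a i : ℂ))
  set B : Matrix (Fin n) (Fin n) ℂ := Matrix.diagonal (fun i => (b i : ℂ))
  have hM : (A + U * B * Uᴴ).PosDef := posDef_diagonal_add_conj_diagonal ha hb U
  set μ := hM.isHermitian.eigenvalues
  have hμpos (i) : 0 < μ i := hM.eigenvalues_pos i
  obtain ⟨X, hX, hXM⟩ : ∃ X ∈ Matrix.unitaryGroup (Fin n) ℂ,
      Xᴴ * (A + U * B * Uᴴ) * X = Matrix.diagonal (fun i => (μ i : ℂ)) :=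
    ⟨hM.isHermitian.eigenvectorUnitary, hM.isHermitian.eigenvectorUnitary.2, by
      have h := hM.isHermitian.conjStarAlgAut_star_eigenvectorUnitary
      rw [Unitary.conjStarAlgAut_star_apply] at h
      exact h⟩
  set τ := Tuple.sort μ
  have hτ : Monotone (μ ∘ τ) := Tuple.monotone_sort μ
  have hanti {f : Fin n → ℝ} (hf : Monotone f) : Antivary (f ∘ τ.symm) (fun i => (μ i)⁻¹) := by
    intro i j hij
    have hlt : μ j < μ i := (inv_lt_inv₀ (hμpos i) (hμpos j)).1 hij
    refine hf ?_
    by_contra! hlt'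
    have := hτ hlt'.le
    simp only [Function.comp_apply, Equiv.apply_symm_apply] at this
    exact absurd this (not_le.2 hlt)
  have hA := sum_mul_le_sum_diag_conj_mul hX (hanti hamono)
  have hY : Uᴴ * X ∈ Matrix.unitaryGroup (Fin n) ℂ :=
    mul_mem (Unitary.star_mem hU) hX
  have hB := sum_mul_le_sum_diag_conj_mul (a := b) (e := τ.symm.trans e) hY (hanti hbmono)
  have hsplit : Xᴴ * A * X + (Uᴴ * X)ᴴ * B * (Uᴴ * X) = Matrix.diagonal (fun i => (μ i : ℂ)) := by
    rw [← hXM, Matrix.conjTranspose_mul, Matrix.conjTranspose_conjTranspose]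
    simp only [Matrix.mul_add, Matrix.add_mul, Matrix.mul_assoc]
  have hdiag (j) : ((Xᴴ * A * X) j j).re + (((Uᴴ * X)ᴴ * B * (Uᴴ * X)) j j).re = μ j := by
    rw [← Complex.add_re, ← Matrix.add_apply, hsplit, Matrix.diagonal_apply_eq, Complex.ofReal_re]
  have hsum : ∑ i, (a (τ.symm i) + b (e (τ.symm i))) * (μ i)⁻¹ ≤ ∑ _i : Fin n, (1 : ℝ) := by
    calc _ = ∑ i, a (τ.symm i) * (μ i)⁻¹ + ∑ i, b (e (τ.symm i)) * (μ i)⁻¹ := by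
          rw [← Finset.sum_add_distrib]
          exact Finset.sum_congr rfl fun i _ => add_mul _ _ _
      _ ≤ _ := add_le_add hA hB
      _ = _ := by
          rw [← Finset.sum_add_distrib]
          refine Finset.sum_congr rfl fun i _ => ?_
          rw [← add_mul, hdiag, mul_inv_cancel₀ (hμpos i).ne']
  have hdet : (A + U * B * Uᴴ).det.re = ∏ i, μ i := by
    rw [hM.isHermitian.det_eq_prod_eigenvalues]
    exact_mod_cast Complex.ofReal_re (∏ i, μ i)
  rw [hdet, Real.log_prod fun i _ => (hμpos i).ne',
    ← Equiv.sum_comp τ.symm (fun i => Real.log (a i + b (e i))), ← sub_nonpos,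
    ← Finset.sum_sub_distrib]
  calc _ ≤ ∑ i, ((a (τ.symm i) + b (e (τ.symm i))) * (μ i)⁻¹ - 1) := by
        refine Finset.sum_le_sum fun i _ => ?_
        have hpos : 0 < a (τ.symm i) + b (e (τ.symm i)) := add_pos_of_pos_of_nonneg (ha _) (hb _)
        rw [← Real.log_div hpos.ne' (hμpos i).ne', div_eq_mul_inv]
        exact Real.log_le_sub_one_of_pos (mul_pos hpos (inv_pos.2 (hμpos i)))
    _ ≤ 0 := by
        rw [Finset.sum_sub_distrib]
        exact sub_nonpos.2 hsum

/-- Lower bound on Eve's rate: for invertible `G` with singular values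
`σ₁ ≥ ... ≥ σₙ` (given by an SVD `G = W · diag σ · Vᴴ`) and positive
semidefinite `Qs` with eigenvalues `p₁ ≥ ... ≥ pₙ` (given by a spectral
decomposition `Qs = T · diag p · Tᴴ`),
`log det (I + G Qs Gᴴ) ≤ ∑ i, log (1 + σᵢ² pᵢ)`. -/
theorem logdet_signal_lower_bound
    (n : ℕ) (G Qs : Matrix (Fin n) (Fin n) ℂ)
    (hG : IsUnit G.det)
    (W V T : Matrix (Fin n) (Fin n) ℂ)
    (hW : W ∈ Matrix.unitaryGroup (Fin n) ℂ)
    (hV : V ∈ Matrix.unitaryGroup (Fin n) ℂ)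
    (hT : T ∈ Matrix.unitaryGroup (Fin n) ℂ)
    (σ p : Fin n → ℝ)
    (hσpos : ∀ i, 0 ≤ σ i) (hσord : Antitone σ)
    (hppos : ∀ i, 0 ≤ p i) (hpord : Antitone p)
    (hsvd : G = W * Matrix.diagonal (fun i => (σ i : ℂ)) * Vᴴ)
    (hspec : Qs = T * Matrix.diagonal (fun i => (p i : ℂ)) * Tᴴ) :
    ∑ i, Real.log (1 + σ i ^ 2 * p (Fin.rev i)) ≤
      Real.log ((1 + G * Qs * Gᴴ).det.re) := by
  have hσne (i) : σ i ≠ 0 := by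
    intro h0
    apply hG.ne_zero
    rw [hsvd, Matrix.det_mul, Matrix.det_mul, Matrix.det_diagonal,
      Finset.prod_eq_zero (Finset.mem_univ i) (by simp [h0])]
    simp
  have hσ (i) : 0 < σ i := (hσpos i).lt_of_ne' (hσne i)
  have hU : Vᴴ * T ∈ Matrix.unitaryGroup (Fin n) ℂ := mul_mem (Unitary.star_mem hV) hT
  have ha (i) : 0 < (σ i ^ 2)⁻¹ := inv_pos.2 (pow_pos (hσ i) 2)
  have hmono : Monotone fun i => (σ i ^ 2)⁻¹ := fun i j hij =>
    inv_anti₀ (pow_pos (hσ j) 2) (pow_le_pow_left₀ (hσpos j) (hσord hij) 2)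
  have hfiedler := sum_log_add_le_log_det_add (e := Fin.revPerm) ha hppos hmono
    (fun i j hij => hpord (Fin.rev_le_rev.2 hij)) hU
  set D : Matrix (Fin n) (Fin n) ℂ := Matrix.diagonal (fun i => (σ i : ℂ)) with hD
  set P : Matrix (Fin n) (Fin n) ℂ := Matrix.diagonal (fun i => (p i : ℂ))
  set A : Matrix (Fin n) (Fin n) ℂ := Matrix.diagonal (fun i => (((σ i ^ 2)⁻¹ : ℝ) : ℂ)) with hA
  have hM := posDef_diagonal_add_conj_diagonal ha hppos (Vᴴ * T)
  have hDA : D * A * D = 1 := by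
    rw [hD, hA, Matrix.diagonal_mul_diagonal, Matrix.diagonal_mul_diagonal,
      ← Matrix.diagonal_one]
    congr 1
    funext i
    have : (σ i : ℂ) ≠ 0 := by exact_mod_cast hσne i
    push_cast
    field_simp
  have hDH : Dᴴ = D := by
    rw [hD, Matrix.diagonal_conjTranspose]
    congr 1
    funext i
    simp
  have hWW : Wᴴ * W = 1 := Matrix.mem_unitaryGroup_iff'.1 hW
  have hfactor : (1 + G * Qs * Gᴴ).det =
      (D * (A + Vᴴ * T * P * (Vᴴ * T)ᴴ) * D).det := by
    have h1 : G * Qs * Gᴴ = W * (D * (Vᴴ * T * P * (Vᴴ * T)ᴴ) * D * Wᴴ) := by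
      rw [hsvd, hspec]
      simp only [Matrix.conjTranspose_mul, Matrix.conjTranspose_conjTranspose, hDH,
        Matrix.mul_assoc]
    rw [h1, Matrix.det_one_add_mul_comm, Matrix.mul_assoc _ Wᴴ W, hWW, Matrix.mul_one,
      Matrix.mul_add, Matrix.add_mul, hDA]
  have hdet : (1 + G * Qs * Gᴴ).det.re =
      (∏ i, σ i ^ 2) * (A + Vᴴ * T * P * (Vᴴ * T)ᴴ).det.re := by
    rw [hfactor, Matrix.det_mul, Matrix.det_mul, mul_right_comm, hD, Matrix.det_diagonal,
      ← Finset.prod_mul_distrib, ← Complex.re_ofReal_mul]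
    push_cast
    simp only [sq]
  have hMre : 0 < (A + Vᴴ * T * P * (Vᴴ * T)ᴴ).det.re := (Complex.pos_iff.1 hM.det_pos).1
  rw [hdet, Real.log_mul (Finset.prod_pos fun i _ => pow_pos (hσ i) 2).ne' hMre.ne',
    Real.log_prod fun i _ => (pow_pos (hσ i) 2).ne']
  refine le_trans (le_of_eq ?_) (add_le_add_right hfiedler _)
  rw [← Finset.sum_add_distrib]
  refine Finset.sum_congr rfl fun i _ => ?_
  rw [← Real.log_mul (pow_pos (hσ i) 2).ne' (add_pos_of_pos_of_nonneg (ha i) (hppos _)).ne',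
    mul_add, mul_inv_cancel₀ (pow_pos (hσ i) 2).ne', Fin.revPerm_apply]
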